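/- Let Ω be a domain in ℝ^N with N ≥ 2, let H be a Finsler norm on ℝ^N, let B satisfy assumption (h_B) with p ≥ 2 and parameters κ ∈ [0,1], γ > 0, Γ > 0, let K ⊂ Ω be compact, and let u be a weak solution of −div(B'(H(∇u))∇H(∇u)) = |u|^{q−1}u in Ω which is stable outside K. Assume Γκ^{p−2}(p−1) ≥ 1 and q > Γ²κ^{p−2}γ^{−1}(p−1)². Then for every β ∈ [1, (2q − Γ²κ^{p−2}γ^{−1}(p−1)² + 2√(q(q − Γ²κ^{p−2}γ^{−1}(p−1)²))) / (Γ²κ^{p−2}γ^{−1}(p−1)²)), every integer l > max{(q+β)/(q−(p−1)), 2}, and every fixed δ > 0, there exists a constant C > 0 such that ∫_Ω |u|^{q+β} φ^{pl} dx ≤ C ∫_{Ω₁} |∇φ|^{2(q+β)/(q−1)} dx + C ∫_{Ω₂} |∇φ|^{p(q+β)/(q−p+1)} dx for every φ ∈ C¹_c(Ω∖K) with 0 ≤ φ ≤ 1. -/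

import Mathlib

open MeasureTheory Real Set
open scoped RealInnerProductSpace

noncomputable section

/-- A Finsler norm on `ℝ^N`: a norm of class `C²` away from the origin whose
open unit ball is uniformly convex. -/
def IsFinslerNorm {N : ℕ} (H : EuclideanSpace ℝ (Fin N) → ℝ) : Prop :=
  (∀ x, H x = 0 ↔ x = 0) ∧
  (∀ (c : ℝ) (x : EuclideanSpace ℝ (Fin N)), H (c • x) = |c| * H x) ∧
  (∀ x y, H (x + y) ≤ H x + H y) ∧
  ContDiffOn ℝ 2 H {(0 : EuclideanSpace ℝ (Fin N))}ᶜ ∧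
  ∃ Λ : ℝ, 0 < Λ ∧ ∀ ξ : EuclideanSpace ℝ (Fin N), H ξ = 1 →
    ∀ v : EuclideanSpace ℝ (Fin N), ⟪gradient H ξ, v⟫ = 0 →
      Λ * ‖v‖ ^ 2 ≤ ⟪fderiv ℝ (gradient H) ξ v, v⟫

/-- Assumption `(h_B)` with parameters `p, κ, γ, Γ`. -/
def SatisfiesHB (B : ℝ → ℝ) (p κ γ Γ : ℝ) : Prop :=
  ContDiffOn ℝ 2 B (Set.Ioi 0) ∧ B 0 = 0 ∧ deriv B 0 = 0 ∧
  (∀ t : ℝ, 0 < t → 0 < B t ∧ 0 < deriv B t ∧ 0 < deriv (deriv B) t) ∧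
  1 < p ∧ 0 ≤ κ ∧ κ ≤ 1 ∧ 0 < γ ∧ 0 < Γ ∧
  (∀ t : ℝ, 0 < t →
    γ * (κ + t) ^ (p - 2) * t ≤ deriv B t ∧ deriv B t ≤ Γ * (κ + t) ^ (p - 2) * t) ∧
  (∀ t : ℝ, 0 < t →
    γ * (p - 1) * (κ + t) ^ (p - 2) ≤ deriv (deriv B) t ∧
      deriv (deriv B) t ≤ Γ * (p - 1) * (κ + t) ^ (p - 2))

/-- `u` is a weak solution of `-div(B'(H(∇u)) ∇H(∇u)) = |u|^{q-1} u` in `Ω`. -/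
def IsWeakSolutionOn {N : ℕ} (Ω : Set (EuclideanSpace ℝ (Fin N))) (B : ℝ → ℝ)
    (H : EuclideanSpace ℝ (Fin N) → ℝ) (u : EuclideanSpace ℝ (Fin N) → ℝ) (q : ℝ) : Prop :=
  ∀ φ : EuclideanSpace ℝ (Fin N) → ℝ, ContDiff ℝ 1 φ → HasCompactSupport φ → tsupport φ ⊆ Ω →
    ∫ x in Ω, deriv B (H (gradient u x)) * ⟪gradient H (gradient u x), gradient φ x⟫
      = ∫ x in Ω, |u x| ^ (q - 1) * u x * φ x

/-- Stability of the linearized operator of `u`, tested against `C¹` functions compactly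
supported in `S ⊆ Ω` (take `S = Ω` for stability, `S = Ω \ K` for stability outside a
compact set `K`). -/
def IsStableOn {N : ℕ} (Ω S : Set (EuclideanSpace ℝ (Fin N))) (B : ℝ → ℝ)
    (H : EuclideanSpace ℝ (Fin N) → ℝ) (u : EuclideanSpace ℝ (Fin N) → ℝ) (q : ℝ) : Prop :=
  ∀ φ : EuclideanSpace ℝ (Fin N) → ℝ, ContDiff ℝ 1 φ → HasCompactSupport φ → tsupport φ ⊆ S →
    0 ≤ (∫ x in Ω, deriv (deriv B) (H (gradient u x)) *
            ⟪gradient H (gradient u x), gradient φ x⟫ ^ 2)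
        + (∫ x in Ω, deriv B (H (gradient u x)) *
            ⟪fderiv ℝ (gradient H) (gradient u x) (gradient φ x), gradient φ x⟫)
        - ∫ x in Ω, q * |u x| ^ (q - 1) * φ x ^ 2

lemma hasDerivAt_abs_rpow_mul_self {s : ℝ} (hs : 0 ≤ s) (t : ℝ) :
    HasDerivAt (fun t : ℝ => |t| ^ s * t) ((s + 1) * |t| ^ s) t := by
  have hne : ∀ y : ℝ, y ≠ 0 → HasDerivAt (fun t : ℝ => |t| ^ s * t) ((s + 1) * |y| ^ s) y := by
    intro y hy
    have hy' : |y| ≠ 0 := abs_ne_zero.mpr hy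
    have h := ((hasDerivAt_abs hy).rpow_const (p := s) (Or.inl hy')).mul (hasDerivAt_id y)
    refine h.congr_deriv ?_
    have h3 : |y| ^ s = |y| ^ (s - 1) * |y| := by
      rw [← rpow_add_one hy']; ring_nf
    have h4 : (SignType.sign y : ℝ) * y = |y| := by
      rcases lt_or_gt_of_ne hy with h | h
      · simp [h, abs_of_neg]
      · simp [h, abs_of_pos]
    simp only [id]
    rw [h3]
    linear_combination (s * |y| ^ (s - 1)) * h4
  by_cases ht : t = 0
  · subst ht
    have hc : Continuous fun t : ℝ => |t| ^ s := continuous_abs.rpow_const fun _ => Or.inr hs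
    exact hasDerivAt_of_hasDerivAt_of_ne hne (hc.mul continuous_id).continuousAt
      (continuous_const.mul hc).continuousAt
  · exact hne t ht

lemma contDiff_abs_rpow_mul_self {s : ℝ} (hs : 0 ≤ s) :
    ContDiff ℝ 1 (fun t : ℝ => |t| ^ s * t) := by
  refine contDiff_one_iff_deriv.2 ⟨fun t => (hasDerivAt_abs_rpow_mul_self hs t).differentiableAt, ?_⟩
  rw [funext fun t => (hasDerivAt_abs_rpow_mul_self hs t).deriv]
  exact continuous_const.mul (continuous_abs.rpow_const fun _ => Or.inr hs)

/-- Young's inequality for weighted geometric means, with a small factor on one term. -/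
lemma exists_const_mul_rpow_mul_rpow_le {θ ε c : ℝ} (hθ : 0 < θ) (hθ' : θ ≤ 1) (hε : 0 < ε)
    (hc : 0 < c) :
    ∃ C : ℝ, 0 < C ∧ ∀ x y : ℝ, 0 ≤ x → 0 ≤ y →
      c * (x ^ (1 - θ) * y ^ θ) ≤ ε * x + C * y := by
  set τ : ℝ := (ε / c) ^ θ⁻¹ with hτ
  have hτ0 : 0 < τ := by positivity
  have hτθ : τ ^ θ = ε / c := by
    rw [hτ, ← rpow_mul (by positivity), inv_mul_cancel₀ hθ.ne', rpow_one]
  refine ⟨c * (τ⁻¹) ^ (1 - θ), by positivity, fun x y hx hy => ?_⟩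
  have key : ∀ z : ℝ, 0 ≤ z → z ^ (1 - θ) * z ^ θ = z := by
    intro z hz
    rw [← rpow_add_of_nonneg hz (by linarith) hθ.le]; simp
  rcases le_total y (τ * x) with h | h
  · have h1 : y ^ θ ≤ (τ * x) ^ θ := rpow_le_rpow hy h hθ.le
    rw [mul_rpow hτ0.le hx, hτθ] at h1
    calc c * (x ^ (1 - θ) * y ^ θ) ≤ c * (x ^ (1 - θ) * (ε / c * x ^ θ)) := by gcongr
      _ = ε * (x ^ (1 - θ) * x ^ θ) := by field_simp
      _ = ε * x := by rw [key x hx]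
      _ ≤ _ := le_add_of_nonneg_right (by positivity)
  · have h1 : x ^ (1 - θ) ≤ (τ⁻¹ * y) ^ (1 - θ) := by
      refine rpow_le_rpow hx ?_ (by linarith)
      rw [inv_mul_eq_div, le_div_iff₀ hτ0]; linarith
    rw [mul_rpow (by positivity) hy] at h1
    calc c * (x ^ (1 - θ) * y ^ θ) ≤ c * (τ⁻¹ ^ (1 - θ) * y ^ (1 - θ) * y ^ θ) := by gcongr
      _ = c * τ⁻¹ ^ (1 - θ) * (y ^ (1 - θ) * y ^ θ) := by ring
      _ = c * τ⁻¹ ^ (1 - θ) * y := by rw [key y hy]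
      _ ≤ _ := le_add_of_nonneg_left (by positivity)

namespace IsFinslerNorm

variable {N : ℕ} {H : EuclideanSpace ℝ (Fin N) → ℝ}

lemma map_zero (hH : IsFinslerNorm H) : H 0 = 0 := (hH.1 0).2 rfl

lemma nonneg (hH : IsFinslerNorm H) (x : EuclideanSpace ℝ (Fin N)) : 0 ≤ H x := by
  have h1 := hH.2.2.1 x ((-1 : ℝ) • x)
  rw [hH.2.1] at h1
  simp only [neg_smul, one_smul, add_neg_cancel, hH.map_zero, abs_neg, abs_one, one_mul] at h1
  linarith

lemma pos (hH : IsFinslerNorm H) {x : EuclideanSpace ℝ (Fin N)} (hx : x ≠ 0) : 0 < H x :=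
  lt_of_le_of_ne (hH.nonneg x) fun h => hx ((hH.1 x).1 h.symm)

lemma map_pos_smul (hH : IsFinslerNorm H) {c : ℝ} (hc : 0 < c) (x : EuclideanSpace ℝ (Fin N)) :
    H (c • x) = c * H x := by rw [hH.2.1, abs_of_pos hc]

lemma contDiffAt (hH : IsFinslerNorm H) {x : EuclideanSpace ℝ (Fin N)} (hx : x ≠ 0) :
    ContDiffAt ℝ 2 H x :=
  hH.2.2.2.1.contDiffAt (isOpen_compl_singleton.mem_nhds hx)

lemma contDiffAt_gradient (hH : IsFinslerNorm H) {x : EuclideanSpace ℝ (Fin N)} (hx : x ≠ 0) :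
    ContDiffAt ℝ 1 (gradient H) x :=
  (InnerProductSpace.toDual ℝ (EuclideanSpace ℝ (Fin N))).symm.contDiff.contDiffAt.comp x
    ((hH.contDiffAt hx).fderiv_right (by norm_num))

lemma gradient_smul (hH : IsFinslerNorm H) {c : ℝ} (hc : 0 < c) (x : EuclideanSpace ℝ (Fin N)) :
    gradient H (c • x) = gradient H x := by
  have h1 : fderiv ℝ (fun y => H (c • y)) x = c • fderiv ℝ H (c • x) := fderiv_comp_smul c
  have h2 : (fun y => H (c • y)) = c • H := funext fun y => hH.map_pos_smul hc y
  rw [h2, fderiv_const_smul_field] at h1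
  unfold gradient
  rw [smul_right_injective _ hc.ne' h1]

lemma fderiv_gradient_smul (hH : IsFinslerNorm H) {c : ℝ} (hc : 0 < c)
    (x : EuclideanSpace ℝ (Fin N)) :
    c • fderiv ℝ (gradient H) (c • x) = fderiv ℝ (gradient H) x := by
  rw [← fderiv_comp_smul]
  exact congrArg (fun f => fderiv ℝ f x) (funext fun y => hH.gradient_smul hc y)

lemma gradient_zero (hH : IsFinslerNorm H) : gradient H 0 = 0 := by
  have h1 : fderiv ℝ (fun y => H ((-1 : ℝ) • y)) 0 = (-1 : ℝ) • fderiv ℝ H ((-1 : ℝ) • 0) :=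
    fderiv_comp_smul (-1)
  have h2 : (fun y => H ((-1 : ℝ) • y)) = H := funext fun y => by rw [hH.2.1]; simp
  rw [h2, smul_zero, neg_smul, one_smul] at h1
  unfold gradient
  have h3 : fderiv ℝ H 0 = 0 := by
    ext v
    have h4 := congrArg (fun L => L v) h1
    simp only [neg_apply] at h4
    simp only [zero_apply]
    linarith
  rw [h3, _root_.map_zero]

lemma inner_gradient_self (hH : IsFinslerNorm H) {x : EuclideanSpace ℝ (Fin N)} (hx : x ≠ 0) :
    ⟪gradient H x, x⟫ = H x := by
  rw [inner_gradient_left]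
  have hd : HasFDerivAt H (fderiv ℝ H x) ((1 : ℝ) • x) := by
    rw [one_smul]
    exact ((hH.contDiffAt hx).differentiableAt (by norm_num)).hasFDerivAt
  have h1 : HasDerivAt (fun t : ℝ => H (t • x)) (fderiv ℝ H x ((1 : ℝ) • x)) 1 :=
    hd.comp_hasDerivAt (1 : ℝ) (f := fun t : ℝ => t • x) ((hasDerivAt_id (1 : ℝ)).smul_const x)
  have h2 : HasDerivAt (fun t : ℝ => t * H x) (1 * H x) 1 := (hasDerivAt_id (1 : ℝ)).mul_const _
  have h3 : (fun t : ℝ => H (t • x)) =ᶠ[nhds 1] fun t : ℝ => t * H x := by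
    filter_upwards [lt_mem_nhds (zero_lt_one (α := ℝ))] with t ht
    exact hH.map_pos_smul ht x
  have h4 := h1.unique (h2.congr_of_eventuallyEq h3)
  simpa using h4

lemma fderiv_gradient_self (hH : IsFinslerNorm H) {x : EuclideanSpace ℝ (Fin N)} (hx : x ≠ 0) :
    fderiv ℝ (gradient H) x x = 0 := by
  have hd : HasFDerivAt (gradient H) (fderiv ℝ (gradient H) x) ((1 : ℝ) • x) := by
    rw [one_smul]
    exact ((hH.contDiffAt_gradient hx).differentiableAt (by norm_num)).hasFDerivAt
  have h1 : HasDerivAt (fun t : ℝ => gradient H (t • x))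
      (fderiv ℝ (gradient H) x ((1 : ℝ) • x)) 1 :=
    hd.comp_hasDerivAt (1 : ℝ) (f := fun t : ℝ => t • x) ((hasDerivAt_id (1 : ℝ)).smul_const x)
  have h3 : (fun t : ℝ => gradient H (t • x)) =ᶠ[nhds 1] fun _ : ℝ => gradient H x := by
    filter_upwards [lt_mem_nhds (zero_lt_one (α := ℝ))] with t ht
    exact hH.gradient_smul ht x
  have h4 := h1.unique ((hasDerivAt_const (1 : ℝ) _).congr_of_eventuallyEq h3)
  simpa using h4

lemma inner_fderiv_gradient_self (hH : IsFinslerNorm H) {x : EuclideanSpace ℝ (Fin N)}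
    (hx : x ≠ 0) (b : EuclideanSpace ℝ (Fin N)) :
    ⟪fderiv ℝ (gradient H) x b, x⟫ = 0 := by
  have hd := ((hH.contDiffAt_gradient hx).differentiableAt (by norm_num)).hasFDerivAt
  have h1 := hd.inner ℝ (hasFDerivAt_id x)
  have h3 : H =ᶠ[nhds x] fun y => ⟪gradient H y, id y⟫ := by
    filter_upwards [isOpen_compl_singleton.mem_nhds hx] with y hy
    exact (hH.inner_gradient_self hy).symm
  have h4 := (h1.congr_of_eventuallyEq h3).fderiv
  have h5 := congrArg (fun L => L b) h4
  simp only [ContinuousLinearMap.comp_apply, ContinuousLinearMap.prod_apply,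
    fderivInnerCLM_apply, id, ContinuousLinearMap.id_apply, ← inner_gradient_left] at h5
  linarith

lemma exists_bounds (hH : IsFinslerNorm H) :
    ∃ M : ℝ, 0 < M ∧ (∀ x, H x ≤ M * ‖x‖) ∧ (∀ x, ‖gradient H x‖ ≤ M) ∧
      ∀ x, H x * ‖fderiv ℝ (gradient H) x‖ ≤ M := by
  have hK := isCompact_sphere (0 : EuclideanSpace ℝ (Fin N)) 1
  have hne : ∀ x ∈ Metric.sphere (0 : EuclideanSpace ℝ (Fin N)) 1, x ≠ 0 := by
    rintro x hx rfl
    simp at hx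
  obtain ⟨M₀, h₀⟩ := hK.exists_bound_of_continuousOn (f := H) fun x hx =>
    (hH.contDiffAt (hne x hx)).continuousAt.continuousWithinAt
  obtain ⟨M₁, h₁⟩ := hK.exists_bound_of_continuousOn (f := gradient H) fun x hx =>
    (hH.contDiffAt_gradient (hne x hx)).continuousAt.continuousWithinAt
  obtain ⟨M₂, h₂⟩ := hK.exists_bound_of_continuousOn (f := fderiv ℝ (gradient H)) fun x hx =>
    ((hH.contDiffAt_gradient (hne x hx)).fderiv_right (m := 0)
      (by norm_num)).continuousAt.continuousWithinAt
  have hsph : ∀ x : EuclideanSpace ℝ (Fin N), x ≠ 0 →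
      ‖x‖⁻¹ • x ∈ Metric.sphere (0 : EuclideanSpace ℝ (Fin N)) 1 := by
    intro x hx
    simp [norm_smul, hx]
  have hH' : ∀ x, H x ≤ |M₀| * ‖x‖ := by
    intro x
    by_cases hx : x = 0
    · simp [hx, hH.map_zero]
    have hn : 0 < ‖x‖ := norm_pos_iff.2 hx
    have h := (le_abs_self _).trans ((h₀ _ (hsph x hx)).trans (le_abs_self M₀))
    rw [hH.map_pos_smul (inv_pos.2 hn), inv_mul_le_iff₀ hn] at h
    linarith
  have hM : |M₀| ≤ |M₀| + |M₁| + |M₀| * |M₂| + 1 := by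
    have := mul_nonneg (abs_nonneg M₀) (abs_nonneg M₂)
    linarith [abs_nonneg M₁]
  refine ⟨|M₀| + |M₁| + |M₀| * |M₂| + 1, by positivity, fun x => ?_, fun x => ?_, fun x => ?_⟩
  · exact (hH' x).trans (mul_le_mul_of_nonneg_right hM (norm_nonneg x))
  · by_cases hx : x = 0
    · rw [hx, hH.gradient_zero, norm_zero]; positivity
    have hn : 0 < ‖x‖ := norm_pos_iff.2 hx
    have h := (h₁ _ (hsph x hx)).trans (le_abs_self M₁)
    rw [hH.gradient_smul (inv_pos.2 hn)] at h
    have := mul_nonneg (abs_nonneg M₀) (abs_nonneg M₂)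
    linarith [abs_nonneg M₀]
  · by_cases hx : x = 0
    · rw [hx, hH.map_zero, zero_mul]; positivity
    have hn : 0 < ‖x‖ := norm_pos_iff.2 hx
    have h := (h₂ _ (hsph x hx)).trans (le_abs_self M₂)
    have h3 : ‖fderiv ℝ (gradient H) x‖ ≤ ‖x‖⁻¹ * |M₂| := by
      rw [← hH.fderiv_gradient_smul (inv_pos.2 hn) x, norm_smul, norm_inv, norm_norm]
      exact mul_le_mul_of_nonneg_left h (by positivity)
    calc H x * ‖fderiv ℝ (gradient H) x‖ ≤ |M₀| * ‖x‖ * (‖x‖⁻¹ * |M₂|) :=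
          mul_le_mul (hH' x) h3 (norm_nonneg _) (by positivity)
      _ = |M₀| * |M₂| := by field_simp
      _ ≤ _ := by linarith [abs_nonneg M₀, abs_nonneg M₁]

lemma continuous (hH : IsFinslerNorm H) : Continuous H := by
  obtain ⟨M, -, hM, -⟩ := hH.exists_bounds
  refine continuous_iff_continuousAt.2 fun x => ?_
  by_cases hx : x = 0
  · subst hx
    have h : Filter.Tendsto (fun x : EuclideanSpace ℝ (Fin N) => M * ‖x‖) (nhds 0) (nhds 0) := by
      have : Continuous fun x : EuclideanSpace ℝ (Fin N) => M * ‖x‖ := by fun_prop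
      simpa using this.tendsto 0
    rw [ContinuousAt, hH.map_zero]
    exact squeeze_zero hH.nonneg hM h
  · exact (hH.contDiffAt hx).continuousAt

end IsFinslerNorm

lemma measurable_gradient {N : ℕ} (f : EuclideanSpace ℝ (Fin N) → ℝ) :
    Measurable (gradient f) :=
  (InnerProductSpace.toDual ℝ (EuclideanSpace ℝ (Fin N))).symm.continuous.measurable.comp
    (measurable_fderiv ℝ f)

lemma integrableOn_of_continuousOn_of_eq_zero {E : Type*} [TopologicalSpace E] [T2Space E]
    [MeasurableSpace E] [OpensMeasurableSpace E] {μ : Measure E} [IsFiniteMeasureOnCompacts μ]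
    {Ω T : Set E} {g : E → ℝ} (hΩ : MeasurableSet Ω) (hT : IsCompact T) (hTΩ : T ⊆ Ω)
    (hg : ContinuousOn g Ω) (h0 : ∀ x ∈ Ω, x ∉ T → g x = 0) : IntegrableOn g Ω μ :=
  ((hg.mono hTΩ).integrableOn_compact hT).of_forall_sdiff_eq_zero hΩ fun x hx => h0 x hx.1 hx.2

lemma tsupport_mul_rpow_subset {E : Type*} [TopologicalSpace E] {v φ : E → ℝ} {r : ℝ}
    (hr : r ≠ 0) : tsupport (fun x => v x * φ x ^ r) ⊆ tsupport φ := by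
  refine closure_mono fun x hx => ?_
  simp only [Function.mem_support] at hx ⊢
  intro h
  exact hx (by rw [h, zero_rpow hr, mul_zero])

section TestFunctions

variable {N : ℕ} {Ω : Set (EuclideanSpace ℝ (Fin N))} {u φ : EuclideanSpace ℝ (Fin N) → ℝ}
  {s r : ℝ}

lemma contDiff_abs_rpow_mul_self_mul_rpow (hΩ : IsOpen Ω) (hu : ContDiffOn ℝ 1 u Ω)
    (hφ : ContDiff ℝ 1 φ) (hsupp : tsupport φ ⊆ Ω) (hs : 0 ≤ s) (hr : 1 ≤ r) :
    ContDiff ℝ 1 (fun x => |u x| ^ s * u x * φ x ^ r) := by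
  refine contDiff_iff_contDiffAt.2 fun x => ?_
  by_cases hx : x ∈ tsupport φ
  · have h1 : ContDiffAt ℝ 1 u x := hu.contDiffAt (hΩ.mem_nhds (hsupp hx))
    have h2 : ContDiffAt ℝ 1 (fun x => |u x| ^ s * u x) x :=
      (contDiff_abs_rpow_mul_self hs).contDiffAt.comp x h1
    have h3 : ContDiff ℝ 1 fun x => φ x ^ r := hφ.rpow_const_of_le (by simpa using hr)
    exact h2.mul h3.contDiffAt
  · have hx' : x ∉ tsupport (fun x => |u x| ^ s * u x * φ x ^ r) :=
      fun h => hx (tsupport_mul_rpow_subset (by linarith) h)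
    exact contDiffAt_const.congr_of_eventuallyEq (notMem_tsupport_iff_eventuallyEq.1 hx')

lemma gradient_abs_rpow_mul_self_mul_rpow (hΩ : IsOpen Ω) (hu : ContDiffOn ℝ 1 u Ω)
    (hφ : ContDiff ℝ 1 φ) (hs : 0 ≤ s) (hr : 1 ≤ r) {x : EuclideanSpace ℝ (Fin N)}
    (hx : x ∈ Ω) :
    gradient (fun x => |u x| ^ s * u x * φ x ^ r) x =
      ((s + 1) * |u x| ^ s * φ x ^ r) • gradient u x +
        (r * φ x ^ (r - 1) * (|u x| ^ s * u x)) • gradient φ x := by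
  have hu' := ((hu.contDiffAt (hΩ.mem_nhds hx)).differentiableAt (by norm_num)).hasFDerivAt
  have hφ' := (hφ.differentiable (by norm_num) x).hasFDerivAt
  have h := ((hasDerivAt_abs_rpow_mul_self hs (u x)).comp_hasFDerivAt x hu').mul
    ((hasDerivAt_rpow_const (Or.inr hr)).comp_hasFDerivAt x hφ')
  have h' := h.fderiv
  unfold gradient
  erw [h']
  simp only [map_add, map_smul, smul_smul, Function.comp]
  rw [add_comm]
  congr 2 <;> ring

end TestFunctions

/-- Absorption of the error terms in the combination of the stability and weak formulations. -/
lemma exists_quadratic_bound {A β lam r M : ℝ} (hA : 0 ≤ A) (hM : 0 ≤ M)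
    (h : A * ((β + 1) / 2) ^ 2 < lam * β) :
    ∃ c C : ℝ, 0 < c ∧ 0 < C ∧ ∀ b₁ b₂ X Y Z k : ℝ, 0 ≤ b₁ → b₂ ≤ A * b₁ →
      |Z| ≤ M * Y → k ≤ b₁ * (M * Y ^ 2) →
      b₂ * ((β + 1) / 2 * X + r / 2 * Z) ^ 2 + (r / 2) ^ 2 * k
        - lam * (b₁ * (β * X ^ 2 + r * (X * Z))) ≤ b₁ * (-(c * X ^ 2) + C * Y ^ 2) := by
  set c := (lam * β - A * ((β + 1) / 2) ^ 2) / 2 with hc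
  have hc0 : 0 < c := by rw [hc]; linarith
  set D := (A * (β + 1) / 2 - lam) * r with hD
  set C₁ := D ^ 2 / (4 * c) + A * r ^ 2 / 4 with hC₁
  have hC₁0 : 0 ≤ C₁ := by positivity
  refine ⟨c, C₁ * M ^ 2 + (r / 2) ^ 2 * M + 1, hc0, by positivity, ?_⟩
  intro b₁ b₂ X Y Z k hb₁ hb₂ hZ hk
  have hZ2 : Z ^ 2 ≤ (M * Y) ^ 2 := sq_le_sq' (neg_le_of_abs_le hZ) (le_of_abs_le hZ)
  have hDXZ : D * (X * Z) ≤ c * X ^ 2 + D ^ 2 / (4 * c) * Z ^ 2 := by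
    have h1 : c * X ^ 2 + D ^ 2 / (4 * c) * Z ^ 2 - D * (X * Z) =
        (2 * c * X - D * Z) ^ 2 / (4 * c) := by field_simp; ring
    have h2 : 0 ≤ (2 * c * X - D * Z) ^ 2 / (4 * c) := by positivity
    linarith
  have h1 : b₂ * ((β + 1) / 2 * X + r / 2 * Z) ^ 2 ≤
      A * b₁ * ((β + 1) / 2 * X + r / 2 * Z) ^ 2 := mul_le_mul_of_nonneg_right hb₂ (sq_nonneg _)
  have h2 : (r / 2) ^ 2 * k ≤ (r / 2) ^ 2 * (b₁ * (M * Y ^ 2)) :=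
    mul_le_mul_of_nonneg_left hk (sq_nonneg _)
  have h3 : A * ((β + 1) / 2 * X + r / 2 * Z) ^ 2 + (r / 2) ^ 2 * (M * Y ^ 2)
      - lam * (β * X ^ 2 + r * (X * Z)) =
      -(2 * c * X ^ 2) + D * (X * Z) + A * r ^ 2 / 4 * Z ^ 2 + (r / 2) ^ 2 * M * Y ^ 2 := by
    rw [hc, hD]; ring
  have h4 : C₁ * Z ^ 2 ≤ C₁ * (M * Y) ^ 2 := mul_le_mul_of_nonneg_left hZ2 hC₁0
  have h5 : A * ((β + 1) / 2 * X + r / 2 * Z) ^ 2 + (r / 2) ^ 2 * (M * Y ^ 2)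
      - lam * (β * X ^ 2 + r * (X * Z)) ≤
      -(c * X ^ 2) + (C₁ * M ^ 2 + (r / 2) ^ 2 * M + 1) * Y ^ 2 := by
    rw [h3]
    have := sq_nonneg Y
    rw [hC₁] at h4 ⊢
    linarith
  have h6 := mul_le_mul_of_nonneg_left h5 hb₁
  linarith

/-- Young's inequality in the region of small gradient. -/
lemma exists_young_small {q β r ε c : ℝ} (hq : 1 < q) (hβ : 1 ≤ β) (hr : 2 ≤ r)
    (hrq : 2 * (q + β) ≤ r * (q - 1)) (hε : 0 < ε) (hc : 0 < c) :
    ∃ C : ℝ, 0 < C ∧ ∀ a f g : ℝ, 0 ≤ a → 0 ≤ f → f ≤ 1 → 0 ≤ g →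
      c * (a ^ (β + 1) * f ^ (r - 2) * g ^ 2) ≤
        ε * (a ^ (q + β) * f ^ r) + C * g ^ (2 * (q + β) / (q - 1)) := by
  have hqβ : 0 < q + β := by linarith
  have hq1 : 0 < q - 1 := by linarith
  obtain ⟨C, hC, hY⟩ := exists_const_mul_rpow_mul_rpow_le (θ := (q - 1) / (q + β))
    (by positivity) (by rw [div_le_one hqβ]; linarith) hε hc
  refine ⟨C, hC, fun a f g ha hf hf1 hg => ?_⟩
  have h := hY (a ^ (q + β) * f ^ ((r - 2) * (q + β) / (β + 1))) (g ^ (2 * (q + β) / (q - 1)))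
    (by positivity) (by positivity)
  have hθ : 1 - (q - 1) / (q + β) = (β + 1) / (q + β) := by field_simp; ring
  have hβ1 : (β + 1) ≠ 0 := by linarith
  have e1 : (a ^ (q + β) * f ^ ((r - 2) * (q + β) / (β + 1))) ^ (1 - (q - 1) / (q + β)) =
      a ^ (β + 1) * f ^ (r - 2) := by
    rw [hθ, mul_rpow (by positivity) (by positivity), ← rpow_mul ha, ← rpow_mul hf]
    congr 2 <;> field_simp
  have e2 : (g ^ (2 * (q + β) / (q - 1))) ^ ((q - 1) / (q + β)) = g ^ 2 := by
    rw [← rpow_mul hg, ← rpow_natCast g 2]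
    congr 1
    field_simp
    norm_num
  rw [e1, e2] at h
  have h2 : f ^ ((r - 2) * (q + β) / (β + 1)) ≤ f ^ r := by
    refine rpow_le_rpow_of_exponent_ge' hf hf1 (by linarith) ?_
    rw [le_div_iff₀ (by linarith)]
    nlinarith
  refine h.trans ?_
  gcongr

/-- Young's inequality in the region of large gradient. -/
lemma exists_young_large {p q β l ε c c' : ℝ} (hp : 2 ≤ p) (hq : p - 1 < q) (hβ : 1 ≤ β)
    (hl : 1 ≤ l) (hlq : q + β ≤ l * (q - (p - 1))) (hε : 0 < ε) (hc : 0 < c) (hc' : 0 < c') :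
    ∃ C : ℝ, 0 < C ∧ ∀ a f g h : ℝ, 0 ≤ a → 0 ≤ f → f ≤ 1 → 0 ≤ g → 0 ≤ h →
      c * (h ^ (p - 2) * (a ^ (β + 1) * f ^ (p * l - 2) * g ^ 2)) ≤
        c' * (h ^ p * (a ^ (β - 1) * f ^ (p * l))) + ε * (a ^ (q + β) * f ^ (p * l)) +
          C * g ^ (p * (q + β) / (q - p + 1)) := by
  have hp0 : 0 < p := by linarith
  have hqβ : 0 < q + β := by linarith
  have hqp : 0 < q - p + 1 := by linarith
  have hβp : 0 < β + p - 1 := by linarith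
  have hpl : 2 ≤ p * l := by nlinarith
  obtain ⟨C₁, hC₁, hY₁⟩ := exists_const_mul_rpow_mul_rpow_le (θ := 2 / p)
    (by positivity) (by rw [div_le_one hp0]; linarith) hc' hc
  obtain ⟨C, hC, hY⟩ := exists_const_mul_rpow_mul_rpow_le (θ := (q - p + 1) / (q + β))
    (by positivity) (by rw [div_le_one hqβ]; linarith) hε hC₁
  refine ⟨C, hC, fun a f g h ha hf hf1 hg hh => ?_⟩
  have h1 := hY₁ (h ^ p * (a ^ (β - 1) * f ^ (p * l)))
    (a ^ (β + p - 1) * f ^ (p * (l - 1)) * g ^ p) (by positivity) (by positivity)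
  have hθ₁ : 1 - 2 / p = (p - 2) / p := by field_simp
  have e1 : (h ^ p * (a ^ (β - 1) * f ^ (p * l))) ^ (1 - 2 / p) *
      (a ^ (β + p - 1) * f ^ (p * (l - 1)) * g ^ p) ^ (2 / p) =
      h ^ (p - 2) * (a ^ (β + 1) * f ^ (p * l - 2) * g ^ 2) := by
    rw [hθ₁, mul_rpow (by positivity) (by positivity), mul_rpow (by positivity) (by positivity),
      mul_rpow (by positivity) (by positivity), mul_rpow (by positivity) (by positivity),
      ← rpow_mul ha, ← rpow_mul ha, ← rpow_mul hf, ← rpow_mul hf, ← rpow_mul hg, ← rpow_mul hh]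
    have ea : a ^ (β + 1) = a ^ ((β - 1) * ((p - 2) / p)) * a ^ ((β + p - 1) * (2 / p)) := by
      rw [← rpow_add_of_nonneg ha (mul_nonneg (by linarith) (div_nonneg (by linarith) hp0.le))
        (by positivity)]
      congr 1
      field_simp
      ring
    have ef : f ^ (p * l - 2) = f ^ (p * l * ((p - 2) / p)) * f ^ (p * (l - 1) * (2 / p)) := by
      rw [← rpow_add_of_nonneg hf
        (mul_nonneg (by positivity) (div_nonneg (by linarith) hp0.le))
        (mul_nonneg (mul_nonneg hp0.le (by linarith)) (by positivity))]
      congr 1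
      field_simp
      ring
    have eg : g ^ (p * (2 / p)) = g ^ 2 := by
      rw [← rpow_natCast g 2]
      congr 1
      field_simp
      norm_num
    have eh : h ^ (p * ((p - 2) / p)) = h ^ (p - 2) := by
      congr 1
      field_simp
    rw [ea, ef, eg, eh]
    ring
  have h2 := hY (a ^ (q + β) * f ^ (p * (l - 1) * (q + β) / (β + p - 1)))
    (g ^ (p * (q + β) / (q - p + 1))) (by positivity) (by positivity)
  have hθ : 1 - (q - p + 1) / (q + β) = (β + p - 1) / (q + β) := by field_simp; ring
  have e2 : (a ^ (q + β) * f ^ (p * (l - 1) * (q + β) / (β + p - 1))) ^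
      (1 - (q - p + 1) / (q + β)) = a ^ (β + p - 1) * f ^ (p * (l - 1)) := by
    rw [hθ, mul_rpow (by positivity) (by positivity), ← rpow_mul ha, ← rpow_mul hf]
    congr 2 <;> field_simp
  have e3 : (g ^ (p * (q + β) / (q - p + 1))) ^ ((q - p + 1) / (q + β)) = g ^ p := by
    rw [← rpow_mul hg]
    congr 1
    field_simp
  rw [e2, e3] at h2
  rw [e1] at h1
  have h3 : f ^ (p * (l - 1) * (q + β) / (β + p - 1)) ≤ f ^ (p * l) := by
    refine rpow_le_rpow_of_exponent_ge' hf hf1 (by linarith) ?_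
    rw [le_div_iff₀ hβp]
    nlinarith
  have h4 : ε * (a ^ (q + β) * f ^ (p * (l - 1) * (q + β) / (β + p - 1))) ≤
      ε * (a ^ (q + β) * f ^ (p * l)) := by gcongr
  linarith

section PrincipalPart

variable {N : ℕ} {H : EuclideanSpace ℝ (Fin N) → ℝ} {B : ℝ → ℝ} {p κ γ Γ : ℝ}

lemma abs_deriv_mul_inner_le (hH : IsFinslerNorm H) (hB : SatisfiesHB B p κ γ Γ) {M : ℝ}
    (hM : ∀ x, ‖gradient H x‖ ≤ M) (ξ b : EuclideanSpace ℝ (Fin N)) :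
    |deriv B (H ξ) * ⟪gradient H ξ, b⟫| ≤ Γ * (κ + H ξ) ^ (p - 2) * H ξ * (M * ‖b‖) := by
  obtain ⟨-, -, hB0, hpos, hp, hκ, -, hγ, hΓ, hB1, -⟩ := hB
  by_cases hξ : ξ = 0
  · rw [hξ, hH.map_zero, hB0]; simp
  have hh := hH.pos hξ
  rw [abs_mul, abs_of_pos (hpos _ hh).2.1]
  refine mul_le_mul (hB1 _ hh).2 ?_ (abs_nonneg _) (by positivity)
  exact (abs_real_inner_le_norm _ _).trans (mul_le_mul_of_nonneg_right (hM ξ) (norm_nonneg b))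

lemma abs_deriv_deriv_mul_inner_sq_le (hH : IsFinslerNorm H) (hB : SatisfiesHB B p κ γ Γ) {M : ℝ}
    (hM : ∀ x, ‖gradient H x‖ ≤ M) (ξ b : EuclideanSpace ℝ (Fin N)) :
    |deriv (deriv B) (H ξ) * ⟪gradient H ξ, b⟫ ^ 2| ≤
      Γ * (p - 1) * (κ + H ξ) ^ (p - 2) * (M * ‖b‖) ^ 2 := by
  obtain ⟨-, -, hB0, hpos, hp, hκ, -, hγ, hΓ, -, hB2⟩ := hB
  have hp1 : 0 < p - 1 := by linarith
  by_cases hξ : ξ = 0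
  · have := hH.nonneg ξ
    rw [hξ, hH.gradient_zero]
    rw [hξ] at this
    simp only [inner_zero_left]
    norm_num
    positivity
  have hh := hH.pos hξ
  rw [abs_mul, abs_of_pos (hpos _ hh).2.2, abs_pow]
  refine mul_le_mul (hB2 _ hh).2 ?_ (by positivity) (by positivity)
  exact pow_le_pow_left₀ (abs_nonneg _) ((abs_real_inner_le_norm _ _).trans
    (mul_le_mul_of_nonneg_right (hM ξ) (norm_nonneg b))) 2

lemma abs_deriv_mul_inner_fderiv_le (hH : IsFinslerNorm H) (hB : SatisfiesHB B p κ γ Γ) {M : ℝ}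
    (hM : ∀ x, H x * ‖fderiv ℝ (gradient H) x‖ ≤ M) (ξ b : EuclideanSpace ℝ (Fin N)) :
    |deriv B (H ξ) * ⟪fderiv ℝ (gradient H) ξ b, b⟫| ≤
      Γ * (κ + H ξ) ^ (p - 2) * (M * ‖b‖ ^ 2) := by
  obtain ⟨-, -, hB0, hpos, hp, hκ, -, hγ, hΓ, hB1, -⟩ := hB
  by_cases hξ : ξ = 0
  · have h1 := hH.nonneg ξ
    have h2 : 0 ≤ M := by simpa [hH.map_zero] using hM 0
    rw [hξ, hH.map_zero, hB0, zero_mul, abs_zero]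
    positivity
  have hh := hH.pos hξ
  have h1 : |⟪fderiv ℝ (gradient H) ξ b, b⟫| ≤ ‖fderiv ℝ (gradient H) ξ‖ * ‖b‖ ^ 2 := by
    refine (abs_real_inner_le_norm _ _).trans ?_
    have := mul_le_mul_of_nonneg_right ((fderiv ℝ (gradient H) ξ).le_opNorm b) (norm_nonneg b)
    linarith
  rw [abs_mul, abs_of_pos (hpos _ hh).2.1]
  calc deriv B (H ξ) * |⟪fderiv ℝ (gradient H) ξ b, b⟫|
      ≤ Γ * (κ + H ξ) ^ (p - 2) * H ξ * (‖fderiv ℝ (gradient H) ξ‖ * ‖b‖ ^ 2) :=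
        mul_le_mul (hB1 _ hh).2 h1 (abs_nonneg _) (by positivity)
    _ = Γ * (κ + H ξ) ^ (p - 2) * (H ξ * ‖fderiv ℝ (gradient H) ξ‖ * ‖b‖ ^ 2) := by ring
    _ ≤ _ := by gcongr; exact hM ξ

variable {Ω : Set (EuclideanSpace ℝ (Fin N))} {u ψ : EuclideanSpace ℝ (Fin N) → ℝ}

lemma continuousOn_gradient (hΩ : IsOpen Ω) (hu : ContDiffOn ℝ 1 u Ω) :
    ContinuousOn (gradient u) Ω :=
  (InnerProductSpace.toDual ℝ (EuclideanSpace ℝ (Fin N))).symm.continuous.comp_continuousOn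
    (hu.continuousOn_fderiv_of_isOpen hΩ le_rfl)

lemma continuous_gradient (hψ : ContDiff ℝ 1 ψ) : Continuous (gradient ψ) :=
  (InnerProductSpace.toDual ℝ (EuclideanSpace ℝ (Fin N))).symm.continuous.comp
    (hψ.continuous_fderiv (by norm_num))

lemma gradient_eq_zero_of_notMem_tsupport {x : EuclideanSpace ℝ (Fin N)} (hx : x ∉ tsupport ψ) :
    gradient ψ x = 0 := by
  rw [(notMem_tsupport_iff_eventuallyEq.1 hx).gradient_eq]
  exact gradient_const x 0

lemma continuousOn_rpow_comp_gradient (hH : IsFinslerNorm H) (hp : 2 ≤ p) (hΩ : IsOpen Ω)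
    (hu : ContDiffOn ℝ 1 u Ω) : ContinuousOn (fun x => (κ + H (gradient u x)) ^ (p - 2)) Ω :=
  (continuousOn_const.add (hH.continuous.comp_continuousOn
    (continuousOn_gradient hΩ hu))).rpow_const fun _ _ => Or.inr (by linarith)

lemma integrableOn_deriv_mul_inner (hH : IsFinslerNorm H) (hB : SatisfiesHB B p κ γ Γ)
    (hp : 2 ≤ p) (hΩ : IsOpen Ω) (hu : ContDiffOn ℝ 1 u Ω) (hψ : ContDiff ℝ 1 ψ)
    (hc : HasCompactSupport ψ) (hsupp : tsupport ψ ⊆ Ω) :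
    IntegrableOn (fun x => deriv B (H (gradient u x)) *
      ⟪gradient H (gradient u x), gradient ψ x⟫) Ω := by
  obtain ⟨M, -, -, hM, -⟩ := hH.exists_bounds
  have hmu := measurable_gradient u
  have hcψ := continuous_gradient hψ
  refine Integrable.mono' (integrableOn_of_continuousOn_of_eq_zero hΩ.measurableSet hc hsupp
    (g := fun x => Γ * (κ + H (gradient u x)) ^ (p - 2) * H (gradient u x) *
      (M * ‖gradient ψ x‖)) ?_ ?_) ?_ ?_
  · exact ((continuousOn_const.mul (continuousOn_rpow_comp_gradient hH hp hΩ hu)).mul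
      (hH.continuous.comp_continuousOn (continuousOn_gradient hΩ hu))).mul
      (continuous_const.mul hcψ.norm).continuousOn
  · intro x _ hx
    simp [gradient_eq_zero_of_notMem_tsupport hx]
  · exact (((measurable_deriv B).comp (hH.continuous.measurable.comp hmu)).mul
      (((measurable_gradient H).comp hmu).inner hcψ.measurable)).aestronglyMeasurable
  · exact ae_of_all _ fun x => abs_deriv_mul_inner_le hH hB hM _ _

lemma integrableOn_deriv_deriv_mul_inner_sq (hH : IsFinslerNorm H) (hB : SatisfiesHB B p κ γ Γ)
    (hp : 2 ≤ p) (hΩ : IsOpen Ω) (hu : ContDiffOn ℝ 1 u Ω) (hψ : ContDiff ℝ 1 ψ)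
    (hc : HasCompactSupport ψ) (hsupp : tsupport ψ ⊆ Ω) :
    IntegrableOn (fun x => deriv (deriv B) (H (gradient u x)) *
      ⟪gradient H (gradient u x), gradient ψ x⟫ ^ 2) Ω := by
  obtain ⟨M, -, -, hM, -⟩ := hH.exists_bounds
  have hmu := measurable_gradient u
  have hcψ := continuous_gradient hψ
  refine Integrable.mono' (integrableOn_of_continuousOn_of_eq_zero hΩ.measurableSet hc hsupp
    (g := fun x => Γ * (p - 1) * (κ + H (gradient u x)) ^ (p - 2) *
      (M * ‖gradient ψ x‖) ^ 2) ?_ ?_) ?_ ?_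
  · exact (continuousOn_const.mul (continuousOn_rpow_comp_gradient hH hp hΩ hu)).mul
      ((continuous_const.mul hcψ.norm).pow 2).continuousOn
  · intro x _ hx
    simp [gradient_eq_zero_of_notMem_tsupport hx]
  · exact (((measurable_deriv (deriv B)).comp (hH.continuous.measurable.comp hmu)).mul
      ((((measurable_gradient H).comp hmu).inner hcψ.measurable).pow_const 2)).aestronglyMeasurable
  · exact ae_of_all _ fun x => abs_deriv_deriv_mul_inner_sq_le hH hB hM _ _

lemma integrableOn_deriv_mul_inner_fderiv (hH : IsFinslerNorm H) (hB : SatisfiesHB B p κ γ Γ)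
    (hp : 2 ≤ p) (hΩ : IsOpen Ω) (hu : ContDiffOn ℝ 1 u Ω) (hψ : ContDiff ℝ 1 ψ)
    (hc : HasCompactSupport ψ) (hsupp : tsupport ψ ⊆ Ω) :
    IntegrableOn (fun x => deriv B (H (gradient u x)) *
      ⟪fderiv ℝ (gradient H) (gradient u x) (gradient ψ x), gradient ψ x⟫) Ω := by
  obtain ⟨M, -, -, -, hM⟩ := hH.exists_bounds
  have hmu := measurable_gradient u
  have hcψ := continuous_gradient hψ
  refine Integrable.mono' (integrableOn_of_continuousOn_of_eq_zero hΩ.measurableSet hc hsupp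
    (g := fun x => Γ * (κ + H (gradient u x)) ^ (p - 2) * (M * ‖gradient ψ x‖ ^ 2)) ?_ ?_) ?_ ?_
  · exact (continuousOn_const.mul (continuousOn_rpow_comp_gradient hH hp hΩ hu)).mul
      (continuous_const.mul (hcψ.norm.pow 2)).continuousOn
  · intro x _ hx
    simp [gradient_eq_zero_of_notMem_tsupport hx]
  · have hD : Measurable fun x =>
        fderiv ℝ (gradient H) (gradient u x) (gradient ψ x) :=
      isBoundedBilinearMap_apply.continuous.measurable.comp
        (((measurable_fderiv ℝ (gradient H)).comp hmu).prodMk hcψ.measurable)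
    exact (((measurable_deriv B).comp (hH.continuous.measurable.comp hmu)).mul
      (hD.inner hcψ.measurable)).aestronglyMeasurable
  · exact ae_of_all _ fun x => abs_deriv_mul_inner_fderiv_le hH hB hM _ _

end PrincipalPart

/-- Young's inequality for the error term, split according to the size `h` of the gradient. -/
lemma exists_young_split {p κ q β l δ ε A c : ℝ} (hp : 2 ≤ p) (hκ : 0 ≤ κ) (hq : p - 1 < q)
    (hq1 : 1 < q) (hβ : 1 ≤ β) (hl : 1 ≤ l) (hlq : q + β ≤ l * (q - (p - 1))) (hδ : 0 < δ)
    (hε : 0 < ε) (hA : 0 < A) (hc : 0 < c) :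
    ∃ C : ℝ, 0 < C ∧ ∀ a f g h : ℝ, 0 ≤ a → 0 ≤ f → f ≤ 1 → 0 ≤ g → 0 < h →
      (κ + h) ^ (p - 2) * (A * (a ^ (β + 1) * f ^ (p * l - 2) * g ^ 2)) -
          (κ + h) ^ (p - 2) * (c * (h ^ 2 * (a ^ (β - 1) * f ^ (p * l)))) ≤
        ε * (a ^ (q + β) * f ^ (p * l)) +
          C * (if h < δ then g ^ (2 * (q + β) / (q - 1))
            else g ^ (p * (q + β) / (q - p + 1))) := by
  have hp0 : 0 < p := by linarith
  have hpl : 2 ≤ p * l := by nlinarith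
  obtain ⟨C₁, hC₁, hsmall⟩ := exists_young_small (r := p * l) hq1 hβ hpl
    (by nlinarith [mul_le_mul_of_nonneg_left hlq hp0.le,
      mul_nonneg (mul_nonneg hp0.le (by linarith : 0 ≤ l)) (by linarith : 0 ≤ p - 2)]) hε
    (show 0 < A * (κ + δ) ^ (p - 2) by positivity)
  obtain ⟨C₂, hC₂, hlarge⟩ := exists_young_large (q := q) (β := β) (l := l) hp hq hβ hl hlq hε
    (show 0 < A * ((κ + δ) / δ) ^ (p - 2) by positivity) hc
  refine ⟨C₁ + C₂, by positivity, fun a f g h ha hf hf1 hg hh => ?_⟩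
  split_ifs with hlt
  · have h1 := hsmall a f g ha hf hf1 hg
    have h2 : (κ + h) ^ (p - 2) ≤ (κ + δ) ^ (p - 2) :=
      rpow_le_rpow (by positivity) (by linarith) (by linarith)
    have h3 := mul_le_mul_of_nonneg_right h2
      (show 0 ≤ A * (a ^ (β + 1) * f ^ (p * l - 2) * g ^ 2) by positivity)
    have h4 : 0 ≤ (κ + h) ^ (p - 2) * (c * (h ^ 2 * (a ^ (β - 1) * f ^ (p * l)))) := by
      positivity
    have h5 : 0 ≤ C₂ * g ^ (2 * (q + β) / (q - 1)) := by positivity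
    linarith
  · have h1 := hlarge a f g h ha hf hf1 hg hh.le
    have h2 : (κ + h) ^ (p - 2) ≤ ((κ + δ) / δ) ^ (p - 2) * h ^ (p - 2) := by
      rw [← mul_rpow (by positivity) hh.le]
      refine rpow_le_rpow (by positivity) ?_ (by linarith)
      rw [div_mul_eq_mul_div, le_div_iff₀ hδ]
      nlinarith [mul_le_mul_of_nonneg_left (not_lt.1 hlt) hκ]
    have h3 := mul_le_mul_of_nonneg_right h2
      (show 0 ≤ A * (a ^ (β + 1) * f ^ (p * l - 2) * g ^ 2) by positivity)
    have h4 : h ^ (p - 2) ≤ (κ + h) ^ (p - 2) :=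
      rpow_le_rpow hh.le (by linarith) (by linarith)
    have h5 := mul_le_mul_of_nonneg_right h4
      (show 0 ≤ c * (h ^ 2 * (a ^ (β - 1) * f ^ (p * l))) by positivity)
    have h6 : h ^ p = h ^ (p - 2) * h ^ 2 := by
      rw [← rpow_natCast h 2, ← rpow_add hh]; norm_num
    rw [h6] at h1
    have h8 : 0 ≤ C₁ * g ^ (p * (q + β) / (q - p + 1)) := by positivity
    linarith

/-- The pointwise form of the estimate: the stability integrand minus `lam` times the weak
formulation integrand, for the test functions `|u|^((β-1)/2) u φ^(pl/2)` and
`|u|^(β-1) u φ^(pl)` respectively. -/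
lemma exists_pointwise_bound {N : ℕ} {H : EuclideanSpace ℝ (Fin N) → ℝ} {B : ℝ → ℝ}
    {p κ γ Γ q β l δ lam ε : ℝ} (hH : IsFinslerNorm H) (hB : SatisfiesHB B p κ γ Γ)
    (hp : 2 ≤ p) (hq : p - 1 < q) (hq1 : 1 < q) (hβ : 1 ≤ β) (hl : 1 ≤ l)
    (hlq : q + β ≤ l * (q - (p - 1))) (hδ : 0 < δ) (hε : 0 < ε)
    (hlam : Γ * (p - 1) / γ * ((β + 1) / 2) ^ 2 < lam * β) :
    ∃ C : ℝ, 0 < C ∧ ∀ (ξ b : EuclideanSpace ℝ (Fin N)) (v f : ℝ), 0 ≤ f → f ≤ 1 →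
      ∀ e₁ e₂ : EuclideanSpace ℝ (Fin N),
      e₁ = ((β - 1 + 1) * |v| ^ (β - 1) * f ^ (p * l)) • ξ +
        ((p * l) * f ^ (p * l - 1) * (|v| ^ (β - 1) * v)) • b →
      e₂ = (((β - 1) / 2 + 1) * |v| ^ ((β - 1) / 2) * f ^ (p * l / 2)) • ξ +
        ((p * l / 2) * f ^ (p * l / 2 - 1) * (|v| ^ ((β - 1) / 2) * v)) • b →
      deriv (deriv B) (H ξ) * ⟪gradient H ξ, e₂⟫ ^ 2 +
          deriv B (H ξ) * ⟪fderiv ℝ (gradient H) ξ e₂, e₂⟫ -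
          lam * (deriv B (H ξ) * ⟪gradient H ξ, e₁⟫) ≤
        ε * (|v| ^ (q + β) * f ^ (p * l)) +
          C * (if H ξ < δ then ‖b‖ ^ (2 * (q + β) / (q - 1))
            else ‖b‖ ^ (p * (q + β) / (q - p + 1))) := by
  obtain ⟨-, -, hB0, hpos, -, hκ, -, hγ, hΓ, hB1, hB2⟩ := hB
  obtain ⟨M, hM0, -, hM1, hM2⟩ := hH.exists_bounds
  have hp0 : 0 < p := by linarith
  have hp1 : 0 < p - 1 := by linarith
  have hq1' : 0 < q - 1 := by linarith
  have hpl : 2 ≤ p * l := by nlinarith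
  obtain ⟨c, C₀, hc, hC₀, hquad⟩ := exists_quadratic_bound (r := p * l)
    (show 0 ≤ Γ * (p - 1) / γ by positivity) hM0.le hlam
  obtain ⟨C, hC, hyoung⟩ := exists_young_split hp hκ hq hq1 hβ hl hlq hδ hε
    (show 0 < Γ * C₀ by positivity) (show 0 < γ * c by positivity)
  refine ⟨C, hC, ?_⟩
  rintro ξ b v f hf hf1 e₁ e₂ rfl rfl
  by_cases hξ : ξ = 0
  · have h1 : H ξ = 0 := by rw [hξ, hH.map_zero]
    have h2 : gradient H ξ = 0 := by rw [hξ, hH.gradient_zero]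
    rw [h1, h2, hB0]
    simp only [inner_zero_left, zero_mul, mul_zero, sub_zero, add_zero]
    norm_num
    positivity
  have hh := hH.pos hξ
  obtain ⟨-, hd1, hd2⟩ := hpos _ hh
  obtain ⟨hB1l, hB1u⟩ := hB1 _ hh
  obtain ⟨-, hB2u⟩ := hB2 _ hh
  have hE := hH.inner_gradient_self hξ
  have hD0 := hH.fderiv_gradient_self hξ
  have hD1 := hH.inner_fderiv_gradient_self hξ b
  have hm := (abs_real_inner_le_norm (gradient H ξ) b).trans
    (mul_le_mul_of_nonneg_right (hM1 ξ) (norm_nonneg b))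
  have hDb : ⟪fderiv ℝ (gradient H) ξ b, b⟫ ≤ ‖fderiv ℝ (gradient H) ξ‖ * ‖b‖ ^ 2 := by
    refine (real_inner_le_norm _ _).trans ?_
    have := mul_le_mul_of_nonneg_right ((fderiv ℝ (gradient H) ξ).le_opNorm b) (norm_nonneg b)
    linarith
  have hM2ξ := hM2 ξ
  simp only [inner_add_right, inner_smul_right, inner_smul_left, map_add,
    map_smul, hE, hD0, hD1, smul_zero, zero_add, mul_zero, RCLike.conj_to_real]
  set h := H ξ with hhdef
  set m := ⟪gradient H ξ, b⟫
  set d := ⟪fderiv ℝ (gradient H) ξ b, b⟫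
  set n := ‖fderiv ℝ (gradient H) ξ‖
  set g := ‖b‖ with hg
  have hg0 : 0 ≤ g := norm_nonneg b
  set P := (κ + h) ^ (p - 2) with hP
  have hP0 : 0 < P := by positivity
  set b₁ := deriv B h / h with hb₁
  have hb₁h : deriv B h = b₁ * h := by rw [hb₁]; field_simp
  have hb₁l : γ * P ≤ b₁ := by rw [hb₁, le_div_iff₀ hh]; exact hB1l
  have hb₁u : b₁ ≤ Γ * P := by rw [hb₁, div_le_iff₀ hh]; exact hB1u
  have hb₁0 : 0 ≤ b₁ := by positivity
  have hb₂ : deriv (deriv B) h ≤ Γ * (p - 1) / γ * b₁ := by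
    refine hB2u.trans ?_
    have := mul_le_mul_of_nonneg_left hb₁l (show 0 ≤ Γ * (p - 1) / γ by positivity)
    refine le_trans (le_of_eq ?_) this
    field_simp
  set t := |v| ^ ((β - 1) / 2) with ht
  set F₂ := f ^ (p * l / 2) with hF₂
  set F₁ := f ^ (p * l / 2 - 1) with hF₁
  have hv0 := abs_nonneg v
  have ht0 : 0 ≤ t := by positivity
  have hF₁0 : 0 ≤ F₁ := by positivity
  have hF₂0 : 0 ≤ F₂ := by positivity
  have et : |v| ^ (β - 1) = t ^ 2 := by
    rw [ht, sq, ← rpow_add_of_nonneg hv0 (by linarith) (by linarith)]; ring_nf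
  have etv : |v| ^ (β + 1) = (t * |v|) ^ 2 := by
    rw [mul_pow, ← et, ← rpow_natCast |v| 2, ← rpow_add_of_nonneg hv0 (by linarith) (by norm_num)]
    congr 1; push_cast; ring
  have eF : f ^ (p * l) = F₂ ^ 2 := by
    rw [hF₂, sq, ← rpow_add_of_nonneg hf (by linarith) (by linarith)]; ring_nf
  have eF1 : f ^ (p * l - 1) = F₂ * F₁ := by
    rw [hF₂, hF₁, ← rpow_add_of_nonneg hf (by linarith) (by linarith)]; ring_nf
  have eF2 : f ^ (p * l - 2) = F₁ ^ 2 := by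
    rw [hF₁, sq, ← rpow_add_of_nonneg hf (by linarith) (by linarith)]; ring_nf
  have hk : b₁ * h * ((t * v * F₁) ^ 2 * d) ≤ b₁ * (M * (t * |v| * F₁ * g) ^ 2) := by
    have h1 : h * d ≤ M * g ^ 2 := by
      have h2 := mul_le_mul_of_nonneg_left hDb hh.le
      have h3 := mul_le_mul_of_nonneg_right hM2ξ (sq_nonneg g)
      linarith
    have h2 := mul_le_mul_of_nonneg_left h1
      (show 0 ≤ b₁ * (t * |v| * F₁) ^ 2 by positivity)
    have h3 : (t * v * F₁) ^ 2 = (t * |v| * F₁) ^ 2 := by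
      simp only [mul_pow, sq_abs]
    rw [h3]
    linarith
  have hZ : |t * v * F₁ * m| ≤ M * (t * |v| * F₁ * g) := by
    rw [abs_mul, abs_mul, abs_mul, abs_of_nonneg ht0, abs_of_nonneg hF₁0]
    have := mul_le_mul_of_nonneg_left hm (show 0 ≤ t * |v| * F₁ by positivity)
    linarith
  have key := hquad b₁ (deriv (deriv B) h) (t * F₂ * h) (t * |v| * F₁ * g) (t * v * F₁ * m)
    (b₁ * h * ((t * v * F₁) ^ 2 * d)) hb₁0 hb₂ hZ hk
  rw [hb₁h, et, eF, eF1]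
  have hY2 : (t * |v| * F₁ * g) ^ 2 = |v| ^ (β + 1) * f ^ (p * l - 2) * g ^ 2 := by
    rw [etv, eF2]; ring
  have hX2 : (t * F₂ * h) ^ 2 = h ^ 2 * (|v| ^ (β - 1) * f ^ (p * l)) := by
    rw [et, eF]; ring
  have hup : b₁ * (-(c * (t * F₂ * h) ^ 2) + C₀ * (t * |v| * F₁ * g) ^ 2) ≤
      P * (Γ * C₀ * (t * |v| * F₁ * g) ^ 2) - P * (γ * c * (t * F₂ * h) ^ 2) := by
    have h1 := mul_le_mul_of_nonneg_right hb₁l (show 0 ≤ c * (t * F₂ * h) ^ 2 by positivity)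
    have h2 := mul_le_mul_of_nonneg_right hb₁u
      (show 0 ≤ C₀ * (t * |v| * F₁ * g) ^ 2 by positivity)
    linarith
  refine le_trans (le_of_eq ?_) ((key.trans (hup.trans_eq (by rw [hY2, hX2]))).trans
    ((hyoung |v| f g h hv0 hf hf1 hg0 hh).trans_eq (by rw [eF])))
  ring

lemma exponent_condition {q A β : ℝ} (hA : 0 < A) (hAq : A < q) (hβ : 1 ≤ β)
    (h : β < (2 * q - A + 2 * √(q * (q - A))) / A) : A * ((β + 1) / 2) ^ 2 < q * β := by
  have hqA : 0 < q - A := by linarith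
  have h1 : A * β + A - 2 * q < 2 * √(q * (q - A)) := by
    rw [lt_div_iff₀ hA] at h; linarith
  have h2 : q - A < √(q * (q - A)) := by
    apply lt_sqrt_of_sq_lt; nlinarith
  have h3 : -(2 * √(q * (q - A))) < A * β + A - 2 * q := by nlinarith
  have h4 := sq_lt_sq' h3 h1
  rw [mul_pow, sq_sqrt (by nlinarith)] at h4
  have h5 : 0 < A * (q * β - A * ((β + 1) / 2) ^ 2) := by nlinarith
  linarith [pos_of_mul_pos_right h5 hA.le]

/-- Proposition 2.1 for solutions stable outside a compact set `K`,
case `Γ κ^{p-2}(p-1) ≥ 1` (Remark 2.2): the integral estimate holds for test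
functions supported in `Ω \ K`. -/
theorem prop_estimate_case_i_stable_outside {N : ℕ} (hN : 2 ≤ N)
    (Ω : Set (EuclideanSpace ℝ (Fin N))) (hΩo : IsOpen Ω) (hΩc : IsConnected Ω)
    (H : EuclideanSpace ℝ (Fin N) → ℝ) (B : ℝ → ℝ)
    (u : EuclideanSpace ℝ (Fin N) → ℝ) (K : Set (EuclideanSpace ℝ (Fin N)))
    (p κ γ Γ q : ℝ)
    (hH : IsFinslerNorm H) (hB : SatisfiesHB B p κ γ Γ) (hp : 2 ≤ p) (hq : 1 < q)
    (hu : ContDiffOn ℝ 1 u Ω) (hK : IsCompact K) (hKΩ : K ⊆ Ω)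
    (hsol : IsWeakSolutionOn Ω B H u q)
    (hstab : IsStableOn Ω (Ω \ K) B H u q)
    (h1 : 1 ≤ Γ * κ ^ (p - 2) * (p - 1))
    (h2 : Γ ^ 2 * κ ^ (p - 2) * γ⁻¹ * (p - 1) ^ 2 < q) :
    ∀ β : ℝ, 1 ≤ β →
      β < (2 * q - Γ ^ 2 * κ ^ (p - 2) * γ⁻¹ * (p - 1) ^ 2 +
            2 * Real.sqrt (q * (q - Γ ^ 2 * κ ^ (p - 2) * γ⁻¹ * (p - 1) ^ 2))) /
          (Γ ^ 2 * κ ^ (p - 2) * γ⁻¹ * (p - 1) ^ 2) →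
    ∀ l : ℕ, max ((q + β) / (q - (p - 1))) 2 < (l : ℝ) →
    ∀ δ : ℝ, 0 < δ →
    ∃ C : ℝ, 0 < C ∧
      ∀ φ : EuclideanSpace ℝ (Fin N) → ℝ, ContDiff ℝ 1 φ → HasCompactSupport φ →
        tsupport φ ⊆ Ω \ K → (∀ x, 0 ≤ φ x) → (∀ x, φ x ≤ 1) →
        (∫ x in Ω, |u x| ^ (q + β) * φ x ^ (p * l)) ≤
          C * (∫ x in {x ∈ Ω | H (gradient u x) < δ},
                ‖gradient φ x‖ ^ (2 * (q + β) / (q - 1))) +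
          C * (∫ x in Ω \ {x ∈ Ω | H (gradient u x) < δ},
                ‖gradient φ x‖ ^ (p * (q + β) / (q - p + 1))) := by
  intro β hβ hβ' l hl δ hδ
  have hB' := hB
  obtain ⟨-, -, -, hpos, -, hκ, -, hγ, hΓ, hB1, -⟩ := hB'
  have hp0 : 0 < p := by linarith
  have hp1 : 0 < p - 1 := by linarith
  have hγΓ : γ ≤ Γ := by
    have h := (hB1 1 one_pos).1.trans (hB1 1 one_pos).2
    have h' : 0 < (κ + 1) ^ (p - 2) := by positivity
    rw [mul_one, mul_one] at h
    exact le_of_mul_le_mul_right h h'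
  set A := Γ ^ 2 * κ ^ (p - 2) * γ⁻¹ * (p - 1) ^ 2 with hA
  have hA₀A : Γ * (p - 1) / γ ≤ A := by
    have h := mul_le_mul_of_nonneg_left h1 (show 0 ≤ Γ * (p - 1) / γ by positivity)
    rw [mul_one] at h
    exact h.trans_eq (by rw [hA]; field_simp)
  have hpA : p - 1 ≤ A := by
    refine le_trans ?_ hA₀A
    rw [le_div_iff₀ hγ]
    nlinarith
  have hqp : p - 1 < q := hpA.trans_lt h2
  have hqβ : 0 < q + β := by linarith
  have hl2 : (2 : ℝ) < l := (le_max_right _ _).trans_lt hl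
  have hlq : q + β ≤ l * (q - (p - 1)) := by
    have h := (le_max_left _ _).trans_lt hl
    rw [div_lt_iff₀ (by linarith)] at h
    exact h.le
  have hcond : Γ * (p - 1) / γ * ((β + 1) / 2) ^ 2 < q * β :=
    (mul_le_mul_of_nonneg_right hA₀A (sq_nonneg _)).trans_lt
      (exponent_condition (by linarith) h2 hβ hβ')
  obtain ⟨lam, hlam, hlamq⟩ : ∃ lam, Γ * (p - 1) / γ * ((β + 1) / 2) ^ 2 < lam * β ∧ lam < q := by
    have hβ0 : 0 < β := by linarith
    obtain ⟨lam, h, h'⟩ := exists_between ((div_lt_iff₀ hβ0).2 hcond)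
    exact ⟨lam, (div_lt_iff₀ hβ0).1 h, h'⟩
  obtain ⟨C, hC, hpt⟩ := exists_pointwise_bound (ε := (q - lam) / 2) hH hB hp hqp hq hβ
    (by linarith) hlq hδ (by linarith) hlam
  have hqlam : 0 < (q - lam) / 2 := by linarith
  refine ⟨C / ((q - lam) / 2), by positivity, fun φ hφ hφc hφs hφ0 hφ1 => ?_⟩
  have hφΩ : tsupport φ ⊆ Ω := hφs.trans sdiff_subset
  have hpl : 4 < p * l := by nlinarith
  set ψ₁ : EuclideanSpace ℝ (Fin N) → ℝ := fun x => |u x| ^ (β - 1) * u x * φ x ^ (p * l) with hψ₁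
  set ψ₂ : EuclideanSpace ℝ (Fin N) → ℝ :=
    fun x => |u x| ^ ((β - 1) / 2) * u x * φ x ^ (p * l / 2) with hψ₂
  have hψ₁d : ContDiff ℝ 1 ψ₁ :=
    contDiff_abs_rpow_mul_self_mul_rpow hΩo hu hφ hφΩ (by linarith) (by linarith)
  have hψ₂d : ContDiff ℝ 1 ψ₂ :=
    contDiff_abs_rpow_mul_self_mul_rpow hΩo hu hφ hφΩ (by linarith) (by linarith)
  have hψ₁s : tsupport ψ₁ ⊆ tsupport φ := tsupport_mul_rpow_subset (by linarith)
  have hψ₂s : tsupport ψ₂ ⊆ tsupport φ := tsupport_mul_rpow_subset (by linarith)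
  have hψ₁c : HasCompactSupport ψ₁ := hφc.of_isClosed_subset (isClosed_tsupport _) hψ₁s
  have hψ₂c : HasCompactSupport ψ₂ := hφc.of_isClosed_subset (isClosed_tsupport _) hψ₂s
  have hweak := hsol ψ₁ hψ₁d hψ₁c (hψ₁s.trans hφΩ)
  have hst := hstab ψ₂ hψ₂d hψ₂c (hψ₂s.trans hφs)
  have hF₁ : ∀ x, |u x| ^ (q - 1) * u x * ψ₁ x = |u x| ^ (q + β) * φ x ^ (p * l) := by
    intro x
    have h : |u x| ^ (q + β) = |u x| ^ (q - 1) * |u x| ^ (β - 1) * |u x| ^ 2 := by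
      rw [← rpow_natCast |u x| 2, ← rpow_add_of_nonneg (abs_nonneg _) (by linarith) (by linarith),
        ← rpow_add_of_nonneg (abs_nonneg _) (by linarith) (by norm_num)]
      congr 1; push_cast; ring
    rw [h, sq_abs, hψ₁]
    ring
  have hF₂ : ∀ x, q * |u x| ^ (q - 1) * ψ₂ x ^ 2 = q * (|u x| ^ (q + β) * φ x ^ (p * l)) := by
    intro x
    have h : |u x| ^ (β - 1) = (|u x| ^ ((β - 1) / 2)) ^ 2 := by
      rw [sq, ← rpow_add_of_nonneg (abs_nonneg _) (by linarith) (by linarith)]; ring_nf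
    have h' : φ x ^ (p * l) = (φ x ^ (p * l / 2)) ^ 2 := by
      rw [sq, ← rpow_add_of_nonneg (hφ0 x) (by linarith) (by linarith)]; ring_nf
    rw [← hF₁, hψ₁, hψ₂]
    simp only [h, h']
    ring
  simp only [hF₁] at hweak
  simp only [hF₂, integral_const_mul] at hst
  have hintS₁ := integrableOn_deriv_deriv_mul_inner_sq hH hB hp hΩo hu hψ₂d hψ₂c
    (hψ₂s.trans hφΩ)
  have hintS₂ := integrableOn_deriv_mul_inner_fderiv hH hB hp hΩo hu hψ₂d hψ₂c (hψ₂s.trans hφΩ)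
  have hintW := integrableOn_deriv_mul_inner hH hB hp hΩo hu hψ₁d hψ₁c (hψ₁s.trans hφΩ)
  have hintF : IntegrableOn (fun x => |u x| ^ (q + β) * φ x ^ (p * l)) Ω := by
    refine integrableOn_of_continuousOn_of_eq_zero hΩo.measurableSet hφc hφΩ ?_ ?_
    · exact (hu.continuousOn.abs.rpow_const fun _ _ => Or.inr hqβ.le).mul
        (hφ.continuous.rpow_const fun _ => Or.inr (by linarith)).continuousOn
    · intro x _ hx
      rw [image_eq_zero_of_notMem_tsupport hx, zero_rpow (by linarith), mul_zero]
  have hintg : ∀ s : ℝ, 0 < s → IntegrableOn (fun x => ‖gradient φ x‖ ^ s) Ω := by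
    intro s hs
    refine integrableOn_of_continuousOn_of_eq_zero hΩo.measurableSet hφc hφΩ
      ((continuous_gradient hφ).norm.rpow_const fun _ => Or.inr hs.le).continuousOn ?_
    intro x _ hx
    rw [gradient_eq_zero_of_notMem_tsupport hx, norm_zero, zero_rpow hs.ne']
  have hg₁ := hintg (2 * (q + β) / (q - 1)) (div_pos (by linarith) (by linarith))
  have hg₂ := hintg (p * (q + β) / (q - p + 1)) (div_pos (by positivity) (by linarith))
  have hHu : Measurable fun x => H (gradient u x) :=
    hH.continuous.measurable.comp (measurable_gradient u)
  have hmeas : MeasurableSet {x | H (gradient u x) < δ} := measurableSet_lt hHu measurable_const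
  set G : EuclideanSpace ℝ (Fin N) → ℝ := fun x => if H (gradient u x) < δ then
    ‖gradient φ x‖ ^ (2 * (q + β) / (q - 1)) else
    ‖gradient φ x‖ ^ (p * (q + β) / (q - p + 1)) with hG
  have hΩ₁ : MeasurableSet {x ∈ Ω | H (gradient u x) < δ} := hΩo.measurableSet.inter hmeas
  have hΩ₂ : MeasurableSet (Ω \ {x ∈ Ω | H (gradient u x) < δ}) := hΩo.measurableSet.diff hΩ₁
  have hG₁ : EqOn G (fun x => ‖gradient φ x‖ ^ (2 * (q + β) / (q - 1)))
      {x ∈ Ω | H (gradient u x) < δ} := fun x hx => if_pos hx.2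
  have hG₂ : EqOn G (fun x => ‖gradient φ x‖ ^ (p * (q + β) / (q - p + 1)))
      (Ω \ {x ∈ Ω | H (gradient u x) < δ}) := fun x hx => if_neg fun h => hx.2 ⟨hx.1, h⟩
  have hGi₁ : IntegrableOn G {x ∈ Ω | H (gradient u x) < δ} :=
    (hg₁.mono_set (sep_subset _ _)).congr_fun hG₁.symm hΩ₁
  have hGi₂ : IntegrableOn G (Ω \ {x ∈ Ω | H (gradient u x) < δ}) :=
    (hg₂.mono_set sdiff_subset).congr_fun hG₂.symm hΩ₂
  have hun : {x ∈ Ω | H (gradient u x) < δ} ∪ Ω \ {x ∈ Ω | H (gradient u x) < δ} = Ω :=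
    union_sdiff_cancel (sep_subset _ _)
  have hintG : IntegrableOn G Ω := hun ▸ hGi₁.union hGi₂
  have hsplit : ∫ x in Ω, G x = (∫ x in {x ∈ Ω | H (gradient u x) < δ},
        ‖gradient φ x‖ ^ (2 * (q + β) / (q - 1))) +
      ∫ x in Ω \ {x ∈ Ω | H (gradient u x) < δ},
        ‖gradient φ x‖ ^ (p * (q + β) / (q - p + 1)) := by
    rw [← setIntegral_congr_fun hΩ₁ hG₁, ← setIntegral_congr_fun hΩ₂ hG₂,
      ← setIntegral_union disjoint_sdiff_right hΩ₂ hGi₁ hGi₂, hun]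
  have hmono := setIntegral_mono_on ((hintS₁.add hintS₂).sub (hintW.const_mul lam))
    ((hintF.const_mul ((q - lam) / 2)).add (hintG.const_mul C)) hΩo.measurableSet
    fun x hx => hpt (gradient u x) (gradient φ x) (u x) (φ x) (hφ0 x) (hφ1 x)
      (gradient ψ₁ x) (gradient ψ₂ x)
      (gradient_abs_rpow_mul_self_mul_rpow hΩo hu hφ (by linarith) (by linarith) hx)
      (gradient_abs_rpow_mul_self_mul_rpow hΩo hu hφ (by linarith) (by linarith) hx)
  rw [integral_sub' (hintS₁.add hintS₂) (hintW.const_mul lam), integral_add' hintS₁ hintS₂,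
    integral_add' (hintF.const_mul _) (hintG.const_mul _), integral_const_mul, integral_const_mul,
    integral_const_mul, hweak, hsplit] at hmono
  rw [← mul_add, div_mul_eq_mul_div, le_div_iff₀ hqlam]
  linarith
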